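/- Every strata-preserving derivation of the 16-dimensional Lie algebra 𝔤 (with stratification V_1 = span{e_1,…,e_10}, V_2 = span{e_11,…,e_16}) is a real scalar multiple of the grading derivation D; that is, every derivation δ of 𝔤 with δ(V_1) ⊆ V_1 and δ(V_2) ⊆ V_2 satisfies δ(X) = λX for all X ∈ V_1 and δ(X) = 2λX for all X ∈ V_2, for some λ ∈ ℝ. -/

import Mathlib

open Module

/-- The listed bracket relations: `(i, j, k, a)` means `[e_i, e_j] = a • e_k`
(1-based indices). -/
def relList : List (ℕ × ℕ × ℕ × ℝ) :=
  [(1,2,11,1), (1,3,13,1), (1,4,14,1), (1,5,15,1), (1,6,16,1),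
   (2,3,13,1), (2,5,12,1), (2,6,14,1),
   (3,5,12,1), (3,6,13,1), (3,7,14,1),
   (4,5,12,1), (4,6,13,1), (4,8,14,1),
   (5,6,13,1), (5,8,12,1), (5,9,14,1),
   (6,8,12,1), (6,9,13,1), (6,10,14,1),
   (7,8,14,1), (7,9,12,1), (7,10,13,1),
   (8,9,13,1), (8,10,14,1), (9,10,12,-1)]

/-- Structure constants determined by a relation list, extended antisymmetrically:
`sc rels i j k` is the coefficient of `e_k` in `[e_i, e_j]` (1-based indices). -/
noncomputable def sc (rels : List (ℕ × ℕ × ℕ × ℝ)) (i j k : ℕ) : ℝ :=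
  ((rels.filter (fun r => r.1 = i ∧ r.2.1 = j ∧ r.2.2.1 = k)).map (fun r => r.2.2.2)).sum
  - ((rels.filter (fun r => r.1 = j ∧ r.2.1 = i ∧ r.2.2.1 = k)).map (fun r => r.2.2.2)).sum

/-- The bilinear bracket on `ℝ^n` determined by the structure constants `sc rels`. -/
noncomputable def bra {n : ℕ} (rels : List (ℕ × ℕ × ℕ × ℝ)) (x y : Fin n → ℝ) :
    Fin n → ℝ :=
  fun k => ∑ i, ∑ j, x i * y j * sc rels (i.val + 1) (j.val + 1) (k.val + 1)

/-- `e i` is the `i`-th standard basis vector of `ℝ^n` (1-based index). -/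
noncomputable def e {n : ℕ} (i : ℕ) : Fin n → ℝ := fun k => if k.val + 1 = i then 1 else 0

/-- The span of all brackets `bra rels x y` with `x ∈ A` and `y ∈ B`. -/
noncomputable def braSpan {n : ℕ} (rels : List (ℕ × ℕ × ℕ × ℝ))
    (A B : Submodule ℝ (Fin n → ℝ)) : Submodule ℝ (Fin n → ℝ) :=
  Submodule.span ℝ {z | ∃ x ∈ A, ∃ y ∈ B, bra rels x y = z}

/-- The strata `V_1 = span{e_1, …, e_10}` and `V_2 = span{e_11, …, e_16}` of the
16-dimensional Lie algebra `𝔤`. -/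
noncomputable def V1 : Submodule ℝ (Fin 16 → ℝ) := Submodule.span ℝ (e '' {i | 1 ≤ i ∧ i ≤ 10})
noncomputable def V2 : Submodule ℝ (Fin 16 → ℝ) := Submodule.span ℝ (e '' {i | 11 ≤ i ∧ i ≤ 16})

theorem sc_cons (a b c : ℕ) (d : ℝ) (t : List (ℕ × ℕ × ℕ × ℝ)) (i j k : ℕ) :
    sc ((a, b, c, d) :: t) i j k = ((if a = i ∧ b = j ∧ c = k then d else 0)
      - (if a = j ∧ b = i ∧ c = k then d else 0)) + sc t i j k := by
  unfold sc
  simp only [List.filter_cons, decide_eq_true_eq]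
  split_ifs <;> simp <;> ring

theorem bra_cons (p q : Fin 16) {a b : ℕ} (ha : p.val + 1 = a) (hb : q.val + 1 = b) (l : ℕ)
    (c : ℝ) (t : List (ℕ × ℕ × ℕ × ℝ)) (x y : Fin 16 → ℝ) (k : Fin 16) :
    bra ((a, b, l, c) :: t) x y k
      = (if l = k.val + 1 then (x p * y q - x q * y p) * c else 0) + bra t x y k := by
  subst ha hb
  unfold bra
  simp only [sc_cons, mul_add (_ * _ : ℝ), Finset.sum_add_distrib, add_left_inj]
  by_cases h : l = k.val + 1
  · simp only [h, and_true, if_true, Fin.val_inj, mul_sub, Finset.sum_sub_distrib,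
      ite_and, mul_ite, mul_zero]
    simp
    ring
  · simp [h]

noncomputable section

/-- The coefficient of `e 11` in the bracket. -/
def q11 (x y : Fin 16 → ℝ) : ℝ :=
    (x 0 * y 1 - x 1 * y 0)

/-- The coefficient of `e 12` in the bracket. -/
def q12 (x y : Fin 16 → ℝ) : ℝ :=
    (x 1 * y 4 - x 4 * y 1) + (x 2 * y 4 - x 4 * y 2) + (x 3 * y 4 - x 4 * y 3) + (x 4 * y 7 - x 7 * y 4) + (x 5 * y 7 - x 7 * y 5) + (x 6 * y 8 - x 8 * y 6) - (x 8 * y 9 - x 9 * y 8)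

/-- The coefficient of `e 13` in the bracket. -/
def q13 (x y : Fin 16 → ℝ) : ℝ :=
    (x 0 * y 2 - x 2 * y 0) + (x 1 * y 2 - x 2 * y 1) + (x 2 * y 5 - x 5 * y 2) + (x 3 * y 5 - x 5 * y 3) + (x 4 * y 5 - x 5 * y 4) + (x 5 * y 8 - x 8 * y 5) + (x 6 * y 9 - x 9 * y 6) + (x 7 * y 8 - x 8 * y 7)

/-- The coefficient of `e 14` in the bracket. -/
def q14 (x y : Fin 16 → ℝ) : ℝ :=
    (x 0 * y 3 - x 3 * y 0) + (x 1 * y 5 - x 5 * y 1) + (x 2 * y 6 - x 6 * y 2) + (x 3 * y 7 - x 7 * y 3) + (x 4 * y 8 - x 8 * y 4) + (x 5 * y 9 - x 9 * y 5) + (x 6 * y 7 - x 7 * y 6) + (x 7 * y 9 - x 9 * y 7)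

/-- The coefficient of `e 15` in the bracket. -/
def q15 (x y : Fin 16 → ℝ) : ℝ :=
    (x 0 * y 4 - x 4 * y 0)

/-- The coefficient of `e 16` in the bracket. -/
def q16 (x y : Fin 16 → ℝ) : ℝ :=
    (x 0 * y 5 - x 5 * y 0)

end

/-- Explicit form of the bracket. -/
theorem bra_eq (x y : Fin 16 → ℝ) : bra relList x y = ![0, 0, 0, 0, 0, 0, 0, 0, 0, 0,
    q11 x y, q12 x y, q13 x y, q14 x y, q15 x y, q16 x y] := by
  funext k
  unfold relList
  rw [bra_cons 0 1 (by rfl) (by rfl), bra_cons 0 2 (by rfl) (by rfl), bra_cons 0 3 (by rfl) (by rfl),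
    bra_cons 0 4 (by rfl) (by rfl), bra_cons 0 5 (by rfl) (by rfl), bra_cons 1 2 (by rfl) (by rfl),
    bra_cons 1 4 (by rfl) (by rfl), bra_cons 1 5 (by rfl) (by rfl), bra_cons 2 4 (by rfl) (by rfl),
    bra_cons 2 5 (by rfl) (by rfl), bra_cons 2 6 (by rfl) (by rfl), bra_cons 3 4 (by rfl) (by rfl),
    bra_cons 3 5 (by rfl) (by rfl), bra_cons 3 7 (by rfl) (by rfl), bra_cons 4 5 (by rfl) (by rfl),
    bra_cons 4 7 (by rfl) (by rfl), bra_cons 4 8 (by rfl) (by rfl), bra_cons 5 7 (by rfl) (by rfl),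
    bra_cons 5 8 (by rfl) (by rfl), bra_cons 5 9 (by rfl) (by rfl), bra_cons 6 7 (by rfl) (by rfl),
    bra_cons 6 8 (by rfl) (by rfl), bra_cons 6 9 (by rfl) (by rfl), bra_cons 7 8 (by rfl) (by rfl),
    bra_cons 7 9 (by rfl) (by rfl), bra_cons 8 9 (by rfl) (by rfl)]
  have h0 : bra [] x y k = 0 := by simp [bra, sc]
  rw [h0]
  fin_cases k <;> simp [q11, q12, q13, q14, q15, q16] <;> ring

theorem e_apply (i : ℕ) (k : Fin 16) : e i k = if k.val + 1 = i then 1 else 0 := rfl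

theorem bra_dec (x y : Fin 16 → ℝ) : bra relList x y =
    q11 x y • e 11 + q12 x y • e 12 + q13 x y • e 13 + q14 x y • e 14 + q15 x y • e 15 + q16 x y • e 16 := by
  rw [bra_eq]
  funext k
  fin_cases k <;> simp [e_apply]

theorem der_coord (δ : (Fin 16 → ℝ) →ₗ[ℝ] (Fin 16 → ℝ))
    (hder : ∀ x y : Fin 16 → ℝ,
      δ (bra relList x y) = bra relList (δ x) y + bra relList x (δ y)) (x y : Fin 16 → ℝ)
    (k : Fin 16) :
    q11 x y * δ (e 11) k + q12 x y * δ (e 12) k + q13 x y * δ (e 13) k + q14 x y * δ (e 14) k + q15 x y * δ (e 15) k + q16 x y * δ (e 16) k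
      = bra relList (δ x) y k + bra relList x (δ y) k := by
  have h := congrFun (hder x y) k
  rw [bra_dec x y] at h
  simpa using h

theorem mem_V1 {x : Fin 16 → ℝ} (hx : x ∈ V1) (k : Fin 16) (hk : 10 ≤ k.val) : x k = 0 := by
  unfold V1 at hx
  induction hx using Submodule.span_induction with
  | mem x h =>
    obtain ⟨i, hi, rfl⟩ := h
    simp only [Set.mem_ofPred_eq] at hi
    simp only [e]
    rw [if_neg (by omega)]
  | zero => rfl
  | add x y _ _ hx hy => simp [hx, hy]
  | smul a x _ hx => simp [hx]

theorem mem_V2 {x : Fin 16 → ℝ} (hx : x ∈ V2) (k : Fin 16) (hk : k.val < 10) : x k = 0 := by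
  unfold V2 at hx
  induction hx using Submodule.span_induction with
  | mem x h =>
    obtain ⟨i, hi, rfl⟩ := h
    simp only [Set.mem_ofPred_eq] at hi
    simp only [e]
    rw [if_neg (by omega)]
  | zero => rfl
  | add x y _ _ hx hy => simp [hx, hy]
  | smul a x _ hx => simp [hx]

theorem eig_span (δ : (Fin 16 → ℝ) →ₗ[ℝ] (Fin 16 → ℝ)) (c : ℝ) (s : Set (Fin 16 → ℝ))
    (h : ∀ x ∈ s, δ x = c • x) : ∀ x ∈ Submodule.span ℝ s, δ x = c • x := by
  intro x hx
  induction hx using Submodule.span_induction with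
  | mem x hx => exact h x hx
  | zero => simp
  | add x y _ _ hx hy => simp [hx, hy]
  | smul a x _ hx => rw [map_smul, hx, smul_comm]

/-- The scalar equations for each pair of generators. -/
theorem der_eqs (δ : (Fin 16 → ℝ) →ₗ[ℝ] (Fin 16 → ℝ))
    (hder : ∀ x y : Fin 16 → ℝ,
      δ (bra relList x y) = bra relList (δ x) y + bra relList x (δ y)) (x y : Fin 16 → ℝ) :
    (q11 x y * δ (e 11) 10 + q12 x y * δ (e 12) 10 + q13 x y * δ (e 13) 10 + q14 x y * δ (e 14) 10 + q15 x y * δ (e 15) 10 + q16 x y * δ (e 16) 10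
      = q11 (δ x) y + q11 x (δ y)) ∧
    (q11 x y * δ (e 11) 11 + q12 x y * δ (e 12) 11 + q13 x y * δ (e 13) 11 + q14 x y * δ (e 14) 11 + q15 x y * δ (e 15) 11 + q16 x y * δ (e 16) 11
      = q12 (δ x) y + q12 x (δ y)) ∧
    (q11 x y * δ (e 11) 12 + q12 x y * δ (e 12) 12 + q13 x y * δ (e 13) 12 + q14 x y * δ (e 14) 12 + q15 x y * δ (e 15) 12 + q16 x y * δ (e 16) 12
      = q13 (δ x) y + q13 x (δ y)) ∧
    (q11 x y * δ (e 11) 13 + q12 x y * δ (e 12) 13 + q13 x y * δ (e 13) 13 + q14 x y * δ (e 14) 13 + q15 x y * δ (e 15) 13 + q16 x y * δ (e 16) 13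
      = q14 (δ x) y + q14 x (δ y)) ∧
    (q11 x y * δ (e 11) 14 + q12 x y * δ (e 12) 14 + q13 x y * δ (e 13) 14 + q14 x y * δ (e 14) 14 + q15 x y * δ (e 15) 14 + q16 x y * δ (e 16) 14
      = q15 (δ x) y + q15 x (δ y)) ∧
    (q11 x y * δ (e 11) 15 + q12 x y * δ (e 12) 15 + q13 x y * δ (e 13) 15 + q14 x y * δ (e 14) 15 + q15 x y * δ (e 15) 15 + q16 x y * δ (e 16) 15
      = q16 (δ x) y + q16 x (δ y)) := by
  refine ⟨?_, ?_, ?_, ?_, ?_, ?_⟩ <;> (rw [der_coord δ hder x y, bra_eq, bra_eq]; rfl)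

set_option maxHeartbeats 40000000 in
/-- The solution of the linear system. -/
theorem der_sol (δ : (Fin 16 → ℝ) →ₗ[ℝ] (Fin 16 → ℝ))
    (hder : ∀ x y : Fin 16 → ℝ,
      δ (bra relList x y) = bra relList (δ x) y + bra relList x (δ y)) :
    (∀ i ∈ Finset.Icc 1 10, ∀ k : Fin 16, k.val < 10 → δ (e i) k = δ (e 5) 4 * e i k) ∧
    (∀ i ∈ Finset.Icc 11 16, ∀ k : Fin 16, 10 ≤ k.val → δ (e i) k = (2 * δ (e 5) 4) * e i k) := by
  have H := fun i j => der_eqs δ hder (e i) (e j)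
  obtain ⟨a, ha⟩ : ∃ a : ℕ → Fin 16 → ℝ, ∀ i k, δ (e i) k = a i k := ⟨_, fun _ _ => rfl⟩
  simp only [q11, q12, q13, q14, q15, q16, e_apply, ha] at H
  simp only [ha]
  clear ha hder
  have H11 := fun i j => (H i j).1
  have H12 := fun i j => (H i j).2.1
  have H13 := fun i j => (H i j).2.2.1
  have H14 := fun i j => (H i j).2.2.2.1
  have H15 := fun i j => (H i j).2.2.2.2.1
  have H16 := fun i j => (H i j).2.2.2.2.2
  have z7_1 : a 7 1 = 0 := by
    have h := H11 1 7; norm_num at h; linarith only [h]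
  have z1_8 : a 1 8 = 0 := by
    have h := H12 1 7; norm_num at h; linarith only [h]
  have z7_4 : a 7 4 = 0 := by
    have h := H15 1 7; norm_num at h; linarith only [h]
  have z7_5 : a 7 5 = 0 := by
    have h := H16 1 7; norm_num at h; linarith only [h]
  have z8_1 : a 8 1 = 0 := by
    have h := H11 1 8; norm_num at h; linarith only [h]
  have z8_4 : a 8 4 = 0 := by
    have h := H15 1 8; norm_num at h; linarith only [h]
  have z8_5 : a 8 5 = 0 := by
    have h := H16 1 8; norm_num at h; linarith only [h]
  have z9_1 : a 9 1 = 0 := by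
    have h := H11 1 9; norm_num at h; linarith only [h]
  have z9_4 : a 9 4 = 0 := by
    have h := H15 1 9; norm_num at h; linarith only [h]
  have z9_5 : a 9 5 = 0 := by
    have h := H16 1 9; norm_num at h; linarith only [h]
  have z10_1 : a 10 1 = 0 := by
    have h := H11 1 10; norm_num at h; linarith only [h]
  have z10_4 : a 10 4 = 0 := by
    have h := H15 1 10; norm_num at h; linarith only [h]
  have z10_5 : a 10 5 = 0 := by
    have h := H16 1 10; norm_num at h; linarith only [h]
  have z13_14 : a 13 14 = 0 := by
    have h := H15 2 3; norm_num at h; linarith only [h]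
  have z13_15 : a 13 15 = 0 := by
    have h := H16 2 3; norm_num at h; linarith only [h]
  have z4_0 : a 4 0 = 0 := by
    have h := H11 2 4; norm_num at h; linarith only [h]
  have z12_15 : a 12 15 = 0 := by
    have h := H16 2 5; norm_num at h; linarith only [h]
  have z14_14 : a 14 14 = 0 := by
    have h := H15 2 6; norm_num at h; linarith only [h]
  have z7_0 : a 7 0 = 0 := by
    have h := H11 2 7; norm_num at h; linarith only [h]
  have z8_0 : a 8 0 = 0 := by
    have h := H11 2 8; norm_num at h; linarith only [h]
  have z9_0 : a 9 0 = 0 := by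
    have h := H11 2 9; norm_num at h; linarith only [h]
  have z10_0 : a 10 0 = 0 := by
    have h := H11 2 10; norm_num at h; linarith only [h]
  have z12_10 : a 12 10 = 0 := by
    have h := H11 3 5; norm_num at h; linarith only [h]
  have z13_10 : a 13 10 = 0 := by
    have h := H11 3 6; norm_num at h; linarith only [h]
  have z14_10 : a 14 10 = 0 := by
    have h := H11 3 7; norm_num at h; linarith only [h]
  have z14_15 : a 14 15 = 0 := by
    have h := H16 3 7; norm_num at h; linarith only [h]
  have z12_14 : a 12 14 = 0 := by
    have h := H15 6 8; norm_num at h; linarith only [h]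
  have z3_1 : a 3 1 = 0 := by
    have h := H11 1 3; norm_num at h; linarith only [h, z13_10]
  have z3_4 : a 3 4 = 0 := by
    have h := H15 1 3; norm_num at h; linarith only [h, z13_14]
  have z3_5 : a 3 5 = 0 := by
    have h := H16 1 3; norm_num at h; linarith only [h, z13_15]
  have z4_1 : a 4 1 = 0 := by
    have h := H11 1 4; norm_num at h; linarith only [h, z14_10]
  have z4_4 : a 4 4 = 0 := by
    have h := H15 1 4; norm_num at h; linarith only [h, z14_14]
  have z4_5 : a 4 5 = 0 := by
    have h := H16 1 4; norm_num at h; linarith only [h, z14_15]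
  have z8_2 : a 8 2 = 0 := by
    have h := H13 1 8; norm_num at h; linarith only [h, z1_8]
  have z3_0 : a 3 0 = 0 := by
    have h := H11 2 3; norm_num at h; linarith only [h, z13_10]
  have z2_4 : a 2 4 = 0 := by
    have h := H12 2 4; norm_num at h; linarith only [h, z4_4]
  have z5_0 : a 5 0 = 0 := by
    have h := H11 2 5; norm_num at h; linarith only [h, z12_10]
  have z2_0 : a 2 0 = 0 := by
    have h := H15 2 5; norm_num at h; linarith only [h, z12_14]
  have z6_0 : a 6 0 = 0 := by
    have h := H11 2 6; norm_num at h; linarith only [h, z14_10]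
  have z2_8 : a 2 8 = 0 := by
    have h := H12 2 7; norm_num at h; linarith only [h, z7_4]
  have z9_6 : a 9 6 = 0 := by
    have h := H14 3 9; norm_num at h; linarith only [h, z3_4]
  have z3_8 : a 3 8 = 0 := by
    have h := H12 3 10; norm_num at h; linarith only [h, z10_4]
  have z4_8 : a 4 8 = 0 := by
    have h := H12 4 7; norm_num at h; linarith only [h, z7_4]
  have z4_9 : a 4 9 = 0 := by
    have h := H13 4 7; norm_num at h; linarith only [h, z7_5]
  have z4_6 : a 4 6 = 0 := by
    have h := H13 4 10; norm_num at h; linarith only [h, z10_5]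
  have z5_9 : a 5 9 = 0 := by
    have h := H13 5 7; norm_num at h; linarith only [h, z7_5]
  have z5_6 : a 5 6 = 0 := by
    have h := H13 5 10; norm_num at h; linarith only [h, z10_5]
  have z13_11 : a 13 11 = 0 := by
    have h := H12 2 3; norm_num at h; linarith only [h, z2_4, z3_4]
  have z2_7 : a 2 7 = 0 := by
    have h := H14 2 4; norm_num at h; linarith only [h, z2_0, z4_5]
  have z2_2 : a 2 2 = 0 := by
    have h := H14 2 7; norm_num at h; linarith only [h, z7_5, z2_7]
  have z2_5 : a 2 5 = 0 := by
    have h := H12 2 8; norm_num at h; linarith only [h, z2_4, z8_4]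
  have z9_2 : a 9 2 = 0 := by
    have h := H13 2 9; norm_num at h; linarith only [h, z2_5, z2_7]
  have z3_7 : a 3 7 = 0 := by
    have h := H14 3 4; norm_num at h; linarith only [h, z3_0, z4_6]
  have z12_13 : a 12 13 = 0 := by
    have h := H14 3 5; norm_num at h; linarith only [h, z5_6, z3_8]
  have z6_4 : a 6 4 = 0 := by
    have h := H12 3 6; norm_num at h; linarith only [h, z13_11, z3_7]
  have z14_11 : a 14 11 = 0 := by
    have h := H12 3 7; norm_num at h; linarith only [h, z7_4, z3_8]
  have z10_6 : a 10 6 = 0 := by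
    have h := H14 3 10; norm_num at h; linarith only [h, z3_5, z3_7]
  have z4_7 : a 4 7 = 0 := by
    have h := H12 4 6; norm_num at h; linarith only [h, z13_11, z6_4]
  have z14_12 : a 14 12 = 0 := by
    have h := H13 4 8; norm_num at h; linarith only [h, z8_5, z4_8]
  have z9_7 : a 9 7 = 0 := by
    have h := H14 4 9; norm_num at h; linarith only [h, z9_0, z4_4]
  have z3_6 : a 3 6 = 0 := by
    have h := H13 3 10; norm_num at h; linarith only [h, z10_0, z10_1, z10_5]
  have z5_7 : a 5 7 = 0 := by
    have h := H14 4 5; norm_num at h; linarith only [h, z12_13, z5_0, z4_8]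
  have z10_7 : a 10 7 = 0 := by
    have h := H14 4 10; norm_num at h; linarith only [h, z10_0, z4_5, z4_7]
  have z5_5 : a 5 5 = 0 := by
    have h := H13 5 9; norm_num at h; linarith only [h, z14_12, z9_5, z5_7]
  have z8_8 : a 8 8 = 0 := by
    have h := H12 7 8; norm_num at h; linarith only [h, z14_11, z7_4, z7_5]
  have z12_12 : a 12 12 = 0 := by
    have h := H13 9 10; norm_num at h; linarith only [h, z10_5, z9_6, z10_7]
  have z5_1 : a 5 1 = 0 := by
    have h := H13 3 5; norm_num at h; linarith only [h, z12_12, z5_0, z3_5, z5_5]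
  have z3_9 : a 3 9 = 0 := by
    have h := H13 3 7; norm_num at h; linarith only [h, z14_12, z7_0, z7_1, z7_5]
  have z5_3 : a 5 3 = 0 := by
    have h := H14 5 8; norm_num at h; linarith only [h, z12_13, z5_6, z8_8, z5_9]
  have z9_3 : a 9 3 = 0 := by
    have h := H12 5 9; norm_num at h; linarith only [h, z14_11, z9_1, z9_2, z5_6, z9_7, z5_9]
  have z11_14 : a 11 14 = 0 := by
    have h := H15 1 2; norm_num at h; linarith only [h, z2_4]
  have z11_15 : a 11 15 = 0 := by
    have h := H16 1 2; norm_num at h; linarith only [h, z2_5]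
  have z1_4 : a 1 4 = 0 := by
    have h := H12 1 3; norm_num at h; linarith only [h, z13_11]
  have z15_10 : a 15 10 = 0 := by
    have h := H11 1 5; norm_num at h; linarith only [h, z5_1]
  have z15_15 : a 15 15 = 0 := by
    have h := H16 1 5; norm_num at h; linarith only [h, z5_5]
  have z16_14 : a 16 14 = 0 := by
    have h := H15 1 6; norm_num at h; linarith only [h, z6_4]
  have z1_5 : a 1 5 = 0 := by
    have h := H12 1 8; norm_num at h; linarith only [h, z1_4]
  have z4_2 : a 4 2 = 0 := by
    have h := H13 2 4; norm_num at h; linarith only [h, z2_5]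
  have z15_13 : a 15 13 = 0 := by
    have h := H14 1 5; norm_num at h; linarith only [h, z5_3, z1_8]
  have z1_7 : a 1 7 = 0 := by
    have h := H13 1 9; norm_num at h; linarith only [h, z9_2, z1_5]
  have z10_3 : a 10 3 = 0 := by
    have h := H14 1 10; norm_num at h; linarith only [h, z1_5, z1_7]
  have z5_2 : a 5 2 = 0 := by
    have h := H13 2 5; norm_num at h; linarith only [h, z12_12, z2_5]
  have z7_8 : a 7 8 = 0 := by
    have h := H14 5 7; norm_num at h; linarith only [h, z5_2, z5_7]
  have z5_8 : a 5 8 = 0 := by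
    have h := H13 5 8; norm_num at h; linarith only [h, z12_12, z8_5]
  have z10_8 : a 10 8 = 0 := by
    have h := H14 5 10; norm_num at h; linarith only [h, z5_5, z5_7]
  have z6_8 : a 6 8 = 0 := by
    have h := H12 6 10; norm_num at h; linarith only [h, z14_11, z10_7]
  have z8_9 : a 8 9 = 0 := by
    have h := H13 7 8; norm_num at h; linarith only [h, z14_12, z7_8]
  have z8_6 : a 8 6 = 0 := by
    have h := H13 8 10; norm_num at h; linarith only [h, z14_12, z10_8]
  have z3_3 : a 3 3 = 0 := by
    have h := H14 3 8; norm_num at h; linarith only [h, z3_6, z8_6, z3_9]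
  have z7_7 : a 7 7 = 0 := by
    have h := H14 4 7; norm_num at h; linarith only [h, z7_0, z4_2, z4_7]
  have z13_13 : a 13 13 = 0 := by
    have h := H14 5 6; norm_num at h; linarith only [h, z5_1, z6_8, z5_9]
  have z9_9 : a 9 9 = 0 := by
    have h := H14 6 9; norm_num at h; linarith only [h, z13_13, z9_1, z6_4]
  have z6_7 : a 6 7 = 0 := by
    have h := H14 4 6; norm_num at h; linarith only [h, z13_13, z6_0, z4_1, z4_9]
  have z10_2 : a 10 2 = 0 := by
    have h := H12 5 10; norm_num at h; linarith only [h, z10_1, z10_3, z10_7, z5_8]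
  have z8_3 : a 8 3 = 0 := by
    have h := H13 6 8; norm_num at h; linarith only [h, z12_12, z8_2, z8_4, z6_8, z8_8]
  have z6_6 : a 6 6 = 0 := by
    have h := H13 6 10; norm_num at h; linarith only [h, z14_12, z10_2, z10_3, z10_4, z10_8]
  have z11_11 : a 11 11 = 0 := by
    have h := H12 1 2; norm_num at h; linarith only [h, z1_4]
  have z16_11 : a 16 11 = 0 := by
    have h := H12 1 6; norm_num at h; linarith only [h, z1_7]
  have z1_6 : a 1 6 = 0 := by
    have h := H13 1 10; norm_num at h; linarith only [h, z10_2]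
  have z2_6 : a 2 6 = 0 := by
    have h := H13 2 10; norm_num at h; linarith only [h, z10_2]
  have z15_12 : a 15 12 = 0 := by
    have h := H13 1 5; norm_num at h; linarith only [h, z5_2, z1_5]
  have z2_9 : a 2 9 = 0 := by
    have h := H12 2 9; norm_num at h; linarith only [h, z9_4, z2_6]
  have z2_3 : a 2 3 = 0 := by
    have h := H14 2 8; norm_num at h; linarith only [h, z8_5, z2_6, z2_9]
  have z6_9 : a 6 9 = 0 := by
    have h := H12 6 9; norm_num at h; linarith only [h, z13_11, z6_6, z9_7]
  have z6_2 : a 6 2 = 0 := by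
    have h := H13 2 6; norm_num at h; linarith only [h, z14_12, z2_2, z2_3, z2_4, z2_8]
  have z6_3 : a 6 3 = 0 := by
    have h := H14 6 8; norm_num at h; linarith only [h, z12_13, z8_1, z6_6, z6_9, z8_9]
  have z1_9 : a 1 9 = 0 := by
    have h := H12 1 9; norm_num at h; linarith only [h, z1_6]
  have z7_2 : a 7 2 = 0 := by
    have h := H13 2 7; norm_num at h; linarith only [h, z2_9]
  have z11_13 : a 11 13 = 0 := by
    have h := H14 1 2; norm_num at h; linarith only [h, z2_3, z1_5]
  have z1_3 : a 1 3 = 0 := by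
    have h := H14 1 8; norm_num at h; linarith only [h, z8_3, z1_6, z1_9]
  have z7_9 : a 7 9 = 0 := by
    have h := H14 6 7; norm_num at h; linarith only [h, z7_1, z6_2, z6_7]
  have z7_3 : a 7 3 = 0 := by
    have h := H12 5 7; norm_num at h; linarith only [h, z7_1, z7_2, z7_7, z5_8]
  have z6_1 : a 6 1 = 0 := by
    have h := H12 5 6; norm_num at h; linarith only [h, z13_11, z6_2, z6_3, z5_7, z6_7]
  have z16_10 : a 16 10 = 0 := by
    have h := H11 1 6; norm_num at h; linarith only [h, z6_1]
  have z1_2 : a 1 2 = 0 := by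
    have h := H14 1 7; norm_num at h; linarith only [h, z7_3, z1_7]
  have z16_12 : a 16 12 = 0 := by
    have h := H13 1 6; norm_num at h; linarith only [h, z1_2, z6_2, z1_3, z1_4, z1_8]
  have z11_12 : a 11 12 = 0 := by
    have h := H13 1 2; norm_num at h; linarith only [h, z1_2, z2_2]
  have d1_2_11 : a 11 10 - a 1 0 - a 2 1 = 0 := by
    have h := H11 1 2; norm_num at h; linarith only [h]
  have d1_3_13 : a 13 12 - a 1 0 - a 1 1 - a 3 2 = 0 := by
    have h := H13 1 3; norm_num at h; linarith only [h, z1_5]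
  have d1_4_14 : a 14 13 - a 1 0 - a 4 3 = 0 := by
    have h := H14 1 4; norm_num at h; linarith only [h, z1_7]
  have d1_5_12 : a 15 11 - a 1 1 = 0 := by
    have h := H12 1 5; norm_num at h; linarith only [h, z1_2, z1_3, z1_7]
  have d1_5_15 : a 15 14 - a 1 0 - a 5 4 = 0 := by
    have h := H15 1 5; norm_num at h; linarith only [h]
  have d1_6_14 : a 16 13 - a 1 1 = 0 := by
    have h := H14 1 6; norm_num at h; linarith only [h, z6_3, z1_9]
  have d1_6_16 : a 16 15 - a 1 0 - a 6 5 = 0 := by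
    have h := H16 1 6; norm_num at h; linarith only [h]
  have d2_3_13 : a 13 12 - a 2 1 - a 3 2 = 0 := by
    have h := H13 2 3; norm_num at h; linarith only [h, z2_0, z2_5]
  have d2_5_12 : a 12 11 - a 2 1 - a 5 4 = 0 := by
    have h := H12 2 5; norm_num at h; linarith only [h, z2_2, z2_3, z2_7]
  have d2_6_14 : a 14 13 - a 2 1 - a 6 5 = 0 := by
    have h := H14 2 6; norm_num at h; linarith only [h, z2_9]
  have d3_5_12 : a 12 11 - a 3 2 - a 5 4 = 0 := by
    have h := H12 3 5; norm_num at h; linarith only [h, z3_1, z3_3, z3_7]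
  have d3_6_13 : a 13 12 - a 3 2 - a 6 5 = 0 := by
    have h := H13 3 6; norm_num at h; linarith only [h, z6_0, z6_1, z3_3, z3_4, z3_8]
  have d3_7_14 : a 14 13 - a 3 2 - a 7 6 = 0 := by
    have h := H14 3 7; norm_num at h; linarith only [h, z3_7]
  have d4_5_12 : a 12 11 - a 4 3 - a 5 4 = 0 := by
    have h := H12 4 5; norm_num at h; linarith only [h, z4_1, z4_2, z4_7]
  have d4_6_13 : a 13 12 - a 4 3 - a 6 5 = 0 := by
    have h := H13 4 6; norm_num at h; linarith only [h, z4_2, z4_4, z4_8]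
  have d4_8_14 : a 14 13 - a 4 3 - a 8 7 = 0 := by
    have h := H14 4 8; norm_num at h; linarith only [h, z8_0, z4_6, z4_9]
  have d5_6_13 : a 13 12 - a 5 4 - a 6 5 = 0 := by
    have h := H13 5 6; norm_num at h; linarith only [h, z5_2, z5_3, z5_8]
  have d5_8_12 : a 12 11 - a 5 4 - a 8 7 = 0 := by
    have h := H12 5 8; norm_num at h; linarith only [h, z8_1, z8_2, z8_3, z5_5]
  have d5_9_14 : a 14 13 - a 5 4 - a 9 8 = 0 := by
    have h := H14 5 9; norm_num at h; linarith only [h]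
  have d6_8_12 : a 12 11 - a 6 5 - a 8 7 = 0 := by
    have h := H12 6 8; norm_num at h; linarith only [h, z6_4]
  have d6_9_13 : a 13 12 - a 6 5 - a 9 8 = 0 := by
    have h := H13 6 9; norm_num at h; linarith only [h, z9_2, z9_3, z9_4, z6_7]
  have d6_10_14 : a 14 13 - a 6 5 - a 10 9 = 0 := by
    have h := H14 6 10; norm_num at h; linarith only [h, z10_1, z6_7]
  have d7_8_14 : a 14 13 - a 7 6 - a 8 7 = 0 := by
    have h := H14 7 8; norm_num at h; linarith only [h, z8_2, z7_3, z7_9]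
  have d7_9_12 : a 12 11 - a 7 6 - a 9 8 = 0 := by
    have h := H12 7 9; norm_num at h; linarith only [h, z7_9]
  have d7_10_13 : a 13 12 - a 7 6 - a 10 9 = 0 := by
    have h := H13 7 10; norm_num at h; linarith only [h]
  have d8_9_13 : a 13 12 - a 8 7 - a 9 8 = 0 := by
    have h := H13 8 9; norm_num at h; linarith only [h, z8_5]
  have d8_10_14 : a 14 13 - a 8 7 - a 10 9 = 0 := by
    have h := H14 8 10; norm_num at h; linarith only [h, z10_3, z8_5, z10_6]
  have d9_10_12 : -a 12 11 + a 9 8 + a 10 9 = 0 := by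
    have h := H12 9 10; norm_num at h; linarith only [h, z10_6]
  obtain ⟨z1_0, z1_1, z2_1, z3_2, z4_3, z6_5, z7_6, z8_7, z9_8, z10_9, z11_10, z12_11, z13_12, z14_13, z15_11, z15_14, z16_13, z16_15⟩ :
      a 1 0 = a 5 4 ∧
      a 1 1 = 0 ∧
      a 2 1 = a 5 4 ∧
      a 3 2 = a 5 4 ∧
      a 4 3 = a 5 4 ∧
      a 6 5 = a 5 4 ∧
      a 7 6 = a 5 4 ∧
      a 8 7 = a 5 4 ∧
      a 9 8 = a 5 4 ∧
      a 10 9 = a 5 4 ∧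
      a 11 10 = 2 * a 5 4 ∧
      a 12 11 = 2 * a 5 4 ∧
      a 13 12 = 2 * a 5 4 ∧
      a 14 13 = 2 * a 5 4 ∧
      a 15 11 = 0 ∧
      a 15 14 = 2 * a 5 4 ∧
      a 16 13 = 0 ∧
      a 16 15 = 2 * a 5 4 := by
    refine ⟨?_, ?_, ?_, ?_, ?_, ?_, ?_, ?_, ?_, ?_, ?_, ?_, ?_, ?_, ?_, ?_, ?_, ?_⟩ <;>
    linarith only [d1_2_11, d1_3_13, d1_4_14, d1_5_12, d1_5_15, d1_6_14, d1_6_16, d2_3_13, d2_5_12, d2_6_14, d3_5_12, d3_6_13, d3_7_14, d4_5_12, d4_6_13, d4_8_14, d5_6_13, d5_8_12, d5_9_14, d6_8_12, d6_9_13, d6_10_14, d7_8_14, d7_9_12, d7_10_13, d8_9_13, d8_10_14, d9_10_12]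
  constructor
  · intro i hi k hk
    rw [Finset.mem_Icc] at hi
    obtain ⟨h1, h2⟩ := hi
    interval_cases i <;> fin_cases k <;> first
      | (exfalso; revert hk; decide)
      | (simp [e_apply]; done)
      | (simp [e_apply]; assumption)
  · intro i hi k hk
    rw [Finset.mem_Icc] at hi
    obtain ⟨h1, h2⟩ := hi
    interval_cases i <;> fin_cases k <;> first
      | (exfalso; revert hk; decide)
      | (simp [e_apply]; assumption)

/-- Every strata-preserving derivation of the 16-dimensional Lie algebra `𝔤` is a
scalar multiple of the grading derivation: `δ = λ` on `V 1` and `δ = 2λ` on `V 2`. -/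
theorem stmt2 (δ : (Fin 16 → ℝ) →ₗ[ℝ] (Fin 16 → ℝ))
    (hder : ∀ x y : Fin 16 → ℝ,
      δ (bra relList x y) = bra relList (δ x) y + bra relList x (δ y))
    (h1 : ∀ x ∈ V1, δ x ∈ V1) (h2 : ∀ x ∈ V2, δ x ∈ V2) :
    ∃ lam : ℝ, (∀ x ∈ V1, δ x = lam • x) ∧ (∀ x ∈ V2, δ x = (2 * lam) • x) := by
  obtain ⟨s1, s2⟩ := der_sol δ hder
  refine ⟨δ (e 5) 4, ?_, ?_⟩
  · refine eig_span δ _ _ ?_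
    rintro _ ⟨i, hi, rfl⟩
    funext k
    by_cases hk : k.val < 10
    · exact s1 i (Finset.mem_Icc.2 hi) k hk
    · have hm : (e i : Fin 16 → ℝ) ∈ V1 := Submodule.subset_span ⟨i, hi, rfl⟩
      rw [mem_V1 (h1 _ hm) k (by omega), Pi.smul_apply, mem_V1 hm k (by omega), smul_zero]
  · refine eig_span δ _ _ ?_
    rintro _ ⟨i, hi, rfl⟩
    funext k
    by_cases hk : 10 ≤ k.val
    · exact s2 i (Finset.mem_Icc.2 hi) k hk
    · have hm : (e i : Fin 16 → ℝ) ∈ V2 := Submodule.subset_span ⟨i, hi, rfl⟩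
      rw [mem_V2 (h2 _ hm) k (by omega), Pi.smul_apply, mem_V2 hm k (by omega), smul_zero]
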